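/- arXiv:2103.08460 — 2 statements merged into one kernel-verified Lean document; each statement's English description precedes it below -/
import Mathlib

section
/- Every p×r complex matrix a can be written as a = b₁ τ b₂ where b₁ is an invertible upper triangular p×p complex matrix, b₂ is an invertible upper triangular r×r complex matrix, and τ is a partial permutation matrix of size p×r. Moreover τ is unique: if b₁ τ b₂ = b₁′ τ′ b₂′ with τ, τ′ partial permutation matrices of size p×r and b₁, b₁′ invertible upper triangular p×p matrices and b₂, b₂′ invertible upper triangular r×r matrices, then τ = τ′. -/
open scoped Classical
open Matrix

noncomputable section

/-- A partial permutation matrix: entries in `{0,1}`, at most one `1` in each row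
and in each column. -/
def IsPartialPerm {m n : ℕ} (τ : Matrix (Fin m) (Fin n) ℂ) : Prop :=
  (∀ i j, τ i j = 0 ∨ τ i j = 1) ∧
  (∀ i j j', τ i j = 1 → τ i j' = 1 → j = j') ∧
  (∀ i i' j, τ i j = 1 → τ i' j = 1 → i = i')

/-- The matrix `A` with the extra last column `c`. -/
def appendCol {p r : ℕ} (A : Matrix (Fin p) (Fin r) ℂ) (c : Fin p → ℂ) :
    Matrix (Fin p) (Fin (r + 1)) ℂ :=
  of fun i => Fin.snoc (A i) (c i)

/-- The square block matrix with rows `(b, v)` and `(0, 1)`. -/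
def borderUpper {r : ℕ} (b : Matrix (Fin r) (Fin r) ℂ) (v : Fin r → ℂ) :
    Matrix (Fin (r + 1)) (Fin (r + 1)) ℂ :=
  of fun i j => Fin.lastCases (motive := fun _ => ℂ) (Fin.snoc (α := fun _ => ℂ) 0 1 j)
    (fun i => appendCol b v i j) i

section Border

variable {p r : ℕ}

@[simp] theorem appendCol_castSucc (A : Matrix (Fin p) (Fin r) ℂ) (c : Fin p → ℂ)
    (i : Fin p) (j : Fin r) : appendCol A c i j.castSucc = A i j := by
  simp [appendCol]

@[simp] theorem appendCol_last (A : Matrix (Fin p) (Fin r) ℂ) (c : Fin p → ℂ)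
    (i : Fin p) : appendCol A c i (Fin.last r) = c i := by
  simp [appendCol]

@[simp] theorem borderUpper_castSucc (b : Matrix (Fin r) (Fin r) ℂ) (v : Fin r → ℂ)
    (i : Fin r) (j : Fin (r + 1)) : borderUpper b v i.castSucc j = appendCol b v i j := by
  simp [borderUpper]

@[simp] theorem borderUpper_last_castSucc (b : Matrix (Fin r) (Fin r) ℂ) (v : Fin r → ℂ)
    (j : Fin r) : borderUpper b v (Fin.last r) j.castSucc = 0 := by
  simp [borderUpper]

@[simp] theorem borderUpper_last_last (b : Matrix (Fin r) (Fin r) ℂ) (v : Fin r → ℂ) :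
    borderUpper b v (Fin.last r) (Fin.last r) = 1 := by
  simp [borderUpper]

theorem mul_appendCol (M : Matrix (Fin p) (Fin p) ℂ) (A : Matrix (Fin p) (Fin r) ℂ)
    (c : Fin p → ℂ) : M * appendCol A c = appendCol (M * A) (M *ᵥ c) := by
  ext i j
  induction j using Fin.lastCases <;> simp [mul_apply, mulVec, dotProduct]

theorem appendCol_mul_borderUpper (A : Matrix (Fin p) (Fin r) ℂ) (c : Fin p → ℂ)
    (b : Matrix (Fin r) (Fin r) ℂ) (v : Fin r → ℂ) :
    appendCol A c * borderUpper b v = appendCol (A * b) (A *ᵥ v + c) := by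
  ext i j
  induction j using Fin.lastCases <;>
    simp [mul_apply, mulVec, dotProduct, Fin.sum_univ_castSucc]

theorem isUnit_iff_diag_ne_zero {b : Matrix (Fin r) (Fin r) ℂ} (hb : b.BlockTriangular id) :
    IsUnit b ↔ ∀ i, b i i ≠ 0 := by
  rw [isUnit_iff_isUnit_det, isUnit_iff_ne_zero, det_of_isUpperTriangular hb,
    Finset.prod_ne_zero_iff]
  simp

theorem blockTriangular_inv_of_isUnit {b : Matrix (Fin r) (Fin r) ℂ} (hu : IsUnit b)
    (hb : b.BlockTriangular id) : b⁻¹.BlockTriangular id := by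
  have := hu.invertible
  exact blockTriangular_inv_of_blockTriangular hb

theorem blockTriangular_borderUpper {b : Matrix (Fin r) (Fin r) ℂ} (hb : b.BlockTriangular id)
    (v : Fin r → ℂ) : (borderUpper b v).BlockTriangular id := by
  intro i j hij
  induction i using Fin.lastCases with
  | last =>
    induction j using Fin.lastCases with
    | last => exact absurd hij (lt_irrefl _)
    | cast j => simp
  | cast i =>
    induction j using Fin.lastCases with
    | last => exact absurd hij (not_lt_of_ge (Fin.le_last _))
    | cast j => simpa using hb (by simpa using hij)

theorem isUnit_borderUpper {b : Matrix (Fin r) (Fin r) ℂ} (hu : IsUnit b)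
    (hb : b.BlockTriangular id) (v : Fin r → ℂ) : IsUnit (borderUpper b v) := by
  rw [isUnit_iff_diag_ne_zero (blockTriangular_borderUpper hb v)]
  intro i
  induction i using Fin.lastCases with
  | last => simp
  | cast i => simpa using (isUnit_iff_diag_ne_zero hb).1 hu i

end Border

section PartialPerm

variable {p r : ℕ} {τ : Matrix (Fin p) (Fin r) ℂ}

theorem IsPartialPerm.eq_zero_of_ne_col (h : IsPartialPerm τ) {i : Fin p} {j j' : Fin r}
    (hij : τ i j = 1) (hne : j' ≠ j) : τ i j' = 0 :=
  (h.1 i j').resolve_right fun h' => hne (h.2.1 i j' j h' hij)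

theorem IsPartialPerm.eq_zero_of_ne_row (h : IsPartialPerm τ) {i i' : Fin p} {j : Fin r}
    (hij : τ i j = 1) (hne : i' ≠ i) : τ i' j = 0 :=
  (h.1 i' j).resolve_right fun h' => hne (h.2.2 i' i j h' hij)

theorem IsPartialPerm.appendCol_zero (h : IsPartialPerm τ) : IsPartialPerm (appendCol τ 0) := by
  refine ⟨fun i j => ?_, fun i j j' => ?_, fun i i' j => ?_⟩
  · induction j using Fin.lastCases <;> simp [h.1]
  · induction j using Fin.lastCases <;> induction j' using Fin.lastCases <;> simp
    exact h.2.1 i _ _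
  · induction j using Fin.lastCases <;> simp
    exact h.2.2 i i' _

theorem IsPartialPerm.appendCol_single (h : IsPartialPerm τ) {i₀ : Fin p}
    (hi₀ : ∀ j, τ i₀ j = 0) : IsPartialPerm (appendCol τ (Pi.single i₀ 1)) := by
  refine ⟨fun i j => ?_, fun i j j' => ?_, fun i i' j => ?_⟩
  · induction j using Fin.lastCases with
    | last => by_cases hi : i = i₀ <;> simp [hi]
    | cast j => simpa using h.1 i j
  · induction j using Fin.lastCases <;> induction j' using Fin.lastCases <;>
      simp [Pi.single_apply]
    · rintro rfl
      simp [hi₀]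
    · rintro h1 rfl
      simp [hi₀] at h1
    · exact h.2.1 i _ _
  · induction j using Fin.lastCases <;> simp [Pi.single_apply]
    · rintro rfl rfl
      rfl
    · exact h.2.2 i i' _

/-- Column operations using the pivots of `τ` clear every pivot row of a vector. -/
theorem IsPartialPerm.exists_mulVec_add (h : IsPartialPerm τ) (c : Fin p → ℂ) :
    ∃ (v : Fin r → ℂ) (d : Fin p → ℂ), c = τ *ᵥ v + d ∧ ∀ i j, τ i j = 1 → d i = 0 := by
  refine ⟨fun j => ∑ k, τ k j * c k, _, (add_sub_cancel _ _).symm, fun i j hij => ?_⟩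
  rw [Pi.sub_apply, sub_eq_zero, mulVec, dotProduct, Finset.sum_eq_single j, hij,
    Finset.sum_eq_single i, hij]
  · simp
  · intro k _ hk
    rw [h.eq_zero_of_ne_row hij hk, zero_mul]
  · simp
  · intro k _ hk
    rw [h.eq_zero_of_ne_col hij hk, zero_mul]
  · simp

/-- If `d` vanishes on the pivot rows of `τ`, then `τ` with extra column `d` is an upper
triangular row transform of a partial permutation matrix. -/
theorem IsPartialPerm.exists_appendCol_eq_mul (h : IsPartialPerm τ) {d : Fin p → ℂ}
    (hd : ∀ i j, τ i j = 1 → d i = 0) :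
    ∃ (b : Matrix (Fin p) (Fin p) ℂ) (σ : Matrix (Fin p) (Fin (r + 1)) ℂ),
      IsUnit b ∧ b.BlockTriangular id ∧ IsPartialPerm σ ∧ appendCol τ d = b * σ := by
  by_cases hd0 : d = 0
  · subst hd0
    exact ⟨1, _, isUnit_one, blockTriangular_one, h.appendCol_zero, (Matrix.one_mul _).symm⟩
  obtain ⟨i, hi, hmax⟩ := {i | d i ≠ 0}.toFinite.exists_maximal (Function.ne_iff.1 hd0)
  have hrow : ∀ j, τ i j = 0 := fun j => (h.1 i j).resolve_right fun h1 => hi (hd i j h1)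
  have htri : ((1 : Matrix (Fin p) (Fin p) ℂ).updateCol i d).BlockTriangular id := by
    intro k l hlk
    have hlk : l < k := hlk
    by_cases hl : l = i
    · subst hl
      rw [updateCol_self]
      by_contra hk
      exact absurd (hmax hk hlk.le) (not_le_of_gt hlk)
    · rw [updateCol_ne hl, one_apply_ne hlk.ne']
  refine ⟨updateCol 1 i d, appendCol τ (Pi.single i 1), ?_, htri, h.appendCol_single hrow, ?_⟩
  · rw [isUnit_iff_diag_ne_zero htri]
    intro k
    by_cases hk : k = i
    · subst hk
      rwa [updateCol_self]
    · simp [updateCol_ne hk]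
  · rw [mul_appendCol]
    congr 1
    · conv_lhs => rw [← Matrix.one_mul τ]
      ext k j
      rw [mul_apply, mul_apply]
      refine Finset.sum_congr rfl fun l _ => ?_
      by_cases hl : l = i
      · simp [hl, hrow]
      · simp [updateCol_ne hl]
    · ext k
      simp

end PartialPerm

theorem exists_bruhat_decomposition (p r : ℕ) (a : Matrix (Fin p) (Fin r) ℂ) :
    ∃ (b₁ : Matrix (Fin p) (Fin p) ℂ) (τ : Matrix (Fin p) (Fin r) ℂ)
      (b₂ : Matrix (Fin r) (Fin r) ℂ),
      IsUnit b₁ ∧ b₁.BlockTriangular id ∧ IsPartialPerm τ ∧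
      IsUnit b₂ ∧ b₂.BlockTriangular id ∧ a = b₁ * τ * b₂ := by
  induction r with
  | zero =>
    exact ⟨1, a, 1, isUnit_one, blockTriangular_one,
      ⟨fun _ j => j.elim0, fun _ j => j.elim0, fun _ _ j => j.elim0⟩,
      isUnit_one, blockTriangular_one, by simp⟩
  | succ r ih =>
    obtain ⟨b₁, τ, b₂, hu₁, ht₁, hτ, hu₂, ht₂, ha⟩ := ih (of fun i j => a i j.castSucc)
    obtain ⟨v, d, hc, hd⟩ := hτ.exists_mulVec_add (b₁⁻¹ *ᵥ fun i => a i (Fin.last r))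
    obtain ⟨b, σ, hu, ht, hσ, hbσ⟩ := hτ.exists_appendCol_eq_mul hd
    refine ⟨b₁ * b, σ, borderUpper b₂ v, hu₁.mul hu, ht₁.mul ht, hσ,
      isUnit_borderUpper hu₂ ht₂ v, blockTriangular_borderUpper ht₂ v, ?_⟩
    rw [Matrix.mul_assoc b₁, ← hbσ, Matrix.mul_assoc, appendCol_mul_borderUpper, mul_appendCol,
      ← hc, ← Matrix.mul_assoc, ← ha, mulVec_mulVec,
      mul_nonsing_inv _ ((isUnit_iff_isUnit_det _).1 hu₁), one_mulVec]
    ext i j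
    induction j using Fin.lastCases <;> simp

/-- If `u τ = τ' w` with `u, w` upper triangular and `u` invertible, then every pivot of `τ` has a
pivot of `τ'` in the same row, weakly to its left. -/
theorem exists_pivot_le {p r : ℕ} {u : Matrix (Fin p) (Fin p) ℂ}
    {w : Matrix (Fin r) (Fin r) ℂ} {τ τ' : Matrix (Fin p) (Fin r) ℂ}
    (hu : IsUnit u) (htu : u.BlockTriangular id) (htw : w.BlockTriangular id)
    (hτ : IsPartialPerm τ) (hτ' : IsPartialPerm τ') (h : u * τ = τ' * w)
    {i : Fin p} {j : Fin r} (hij : τ i j = 1) : ∃ l ≤ j, τ' i l = 1 := by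
  have hne : (u * τ) i j ≠ 0 := by
    rw [mul_apply, Finset.sum_eq_single i]
    · simpa [hij] using (isUnit_iff_diag_ne_zero htu).1 hu i
    · intro k _ hk
      rw [hτ.eq_zero_of_ne_row hij hk, mul_zero]
    · simp
  rw [h, mul_apply] at hne
  obtain ⟨l, -, hl⟩ := Finset.exists_ne_zero_of_sum_ne_zero hne
  refine ⟨l, ?_, (hτ'.1 i l).resolve_left (left_ne_zero_of_mul hl)⟩
  by_contra hlt
  exact right_ne_zero_of_mul hl (htw (not_le.1 hlt))

theorem mul_eq_mul_of_bruhat_eq {p r : ℕ} {b₁ b₁' : Matrix (Fin p) (Fin p) ℂ}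
    {τ τ' : Matrix (Fin p) (Fin r) ℂ} {b₂ b₂' : Matrix (Fin r) (Fin r) ℂ}
    (hu₂ : IsUnit b₂) (hu₁' : IsUnit b₁') (h : b₁ * τ * b₂ = b₁' * τ' * b₂') :
    b₁'⁻¹ * b₁ * τ = τ' * (b₂' * b₂⁻¹) := by
  have h₂ := (isUnit_iff_isUnit_det _).1 hu₂
  have h₁ := (isUnit_iff_isUnit_det _).1 hu₁'
  calc b₁'⁻¹ * b₁ * τ = b₁'⁻¹ * (b₁ * τ * b₂ * b₂⁻¹) := by
        rw [mul_nonsing_inv_cancel_right _ _ h₂, Matrix.mul_assoc]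
    _ = τ' * (b₂' * b₂⁻¹) := by
        rw [h, Matrix.mul_assoc b₁', Matrix.mul_assoc b₁', nonsing_inv_mul_cancel_left _ _ h₁,
          Matrix.mul_assoc]

theorem apply_eq_one_of_bruhat_eq {p r : ℕ} {b₁ b₁' : Matrix (Fin p) (Fin p) ℂ}
    {τ τ' : Matrix (Fin p) (Fin r) ℂ} {b₂ b₂' : Matrix (Fin r) (Fin r) ℂ}
    (hu₁ : IsUnit b₁) (ht₁ : b₁.BlockTriangular id) (hτ : IsPartialPerm τ)
    (hu₂ : IsUnit b₂) (ht₂ : b₂.BlockTriangular id)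
    (hu₁' : IsUnit b₁') (ht₁' : b₁'.BlockTriangular id) (hτ' : IsPartialPerm τ')
    (hu₂' : IsUnit b₂') (ht₂' : b₂'.BlockTriangular id)
    (h : b₁ * τ * b₂ = b₁' * τ' * b₂') {i : Fin p} {j : Fin r} (hij : τ i j = 1) :
    τ' i j = 1 := by
  obtain ⟨l, hlj, hl⟩ := exists_pivot_le ((isUnit_nonsing_inv_iff.2 hu₁').mul hu₁)
    ((blockTriangular_inv_of_isUnit hu₁' ht₁').mul ht₁)
    (ht₂'.mul (blockTriangular_inv_of_isUnit hu₂ ht₂)) hτ hτ'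
    (mul_eq_mul_of_bruhat_eq hu₂ hu₁' h) hij
  obtain ⟨l', hl'l, hl'⟩ := exists_pivot_le ((isUnit_nonsing_inv_iff.2 hu₁).mul hu₁')
    ((blockTriangular_inv_of_isUnit hu₁ ht₁).mul ht₁')
    (ht₂.mul (blockTriangular_inv_of_isUnit hu₂' ht₂')) hτ' hτ
    (mul_eq_mul_of_bruhat_eq hu₂' hu₁ h.symm) hl
  have hjl : j ≤ l := hτ.2.1 i l' j hl' hij ▸ hl'l
  exact le_antisymm hlj hjl ▸ hl

/-- every `p × r` complex matrix is `b₁ τ b₂` with `b₁, b₂` invertible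
upper triangular and `τ` a partial permutation matrix, `τ` being unique. -/
theorem bruhat_decomposition_partial_perm (p r : ℕ) :
    (∀ a : Matrix (Fin p) (Fin r) ℂ,
      ∃ (b₁ : Matrix (Fin p) (Fin p) ℂ) (τ : Matrix (Fin p) (Fin r) ℂ)
        (b₂ : Matrix (Fin r) (Fin r) ℂ),
        IsUnit b₁ ∧ b₁.BlockTriangular id ∧ IsPartialPerm τ ∧
        IsUnit b₂ ∧ b₂.BlockTriangular id ∧ a = b₁ * τ * b₂) ∧
    (∀ (b₁ b₁' : Matrix (Fin p) (Fin p) ℂ) (τ τ' : Matrix (Fin p) (Fin r) ℂ)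
        (b₂ b₂' : Matrix (Fin r) (Fin r) ℂ),
        IsUnit b₁ → b₁.BlockTriangular id → IsPartialPerm τ →
        IsUnit b₂ → b₂.BlockTriangular id →
        IsUnit b₁' → b₁'.BlockTriangular id → IsPartialPerm τ' →
        IsUnit b₂' → b₂'.BlockTriangular id →
        b₁ * τ * b₂ = b₁' * τ' * b₂' → τ = τ') := by
  refine ⟨exists_bruhat_decomposition p r, ?_⟩
  intro b₁ b₁' τ τ' b₂ b₂' hu₁ ht₁ hτ hu₂ ht₂ hu₁' ht₁' hτ' hu₂' ht₂' h
  ext i j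
  have hiff : τ i j = 1 ↔ τ' i j = 1 :=
    ⟨apply_eq_one_of_bruhat_eq hu₁ ht₁ hτ hu₂ ht₂ hu₁' ht₁' hτ' hu₂' ht₂' h,
      apply_eq_one_of_bruhat_eq hu₁' ht₁' hτ' hu₂' ht₂' hu₁ ht₁ hτ hu₂ ht₂ h.symm⟩
  rcases hτ.1 i j with h0 | h1
  · rcases hτ'.1 i j with h0' | h1'
    · rw [h0, h0']
    · rw [h1', hiff.2 h1']
  · rw [h1, hiff.1 h1]
end
end

section
/- Every (p+q)×r complex matrix a of rank r can be written as a = diag(b₁, b₂) · ω · g, where b₁ is an invertible upper triangular p×p matrix, b₂ is an invertible upper triangular q×q matrix, diag(b₁,b₂) is the corresponding block-diagonal (p+q)×(p+q) matrix, g ∈ GL_r(ℂ), and ω ∈ 𝕋. Moreover ω is unique up to right multiplication by an r×r permutation matrix: if diag(b₁,b₂) ω g = diag(b₁′,b₂′) ω′ g′ are two such decompositions, then ω′ = ω P for some r×r permutation matrix P. -/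
open scoped Classical
open Matrix

noncomputable section

/-- `(p+q) × r` complex matrices, rows indexed by `Fin p ⊕ Fin q`. -/
abbrev MatT (p q r : ℕ) := Matrix (Fin p ⊕ Fin q) (Fin r) ℂ

/-- The set `𝕋`: `(p+q) × r` matrices of rank `r` whose top `p × r` and bottom
`q × r` blocks are partial permutation matrices. -/
def InT {p q r : ℕ} (ω : MatT p q r) : Prop :=
  ω.rank = r ∧
  IsPartialPerm (Matrix.of fun (i : Fin p) (c : Fin r) => ω (Sum.inl i) c) ∧
  IsPartialPerm (Matrix.of fun (j : Fin q) (c : Fin r) => ω (Sum.inr j) c)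

/-- The permutation matrix of `w`: `(P_w)_{i,j} = 1` iff `i = w j`. -/
def permMat {r : ℕ} (w : Equiv.Perm (Fin r)) : Matrix (Fin r) (Fin r) ℂ :=
  Matrix.of fun i j => if i = w j then 1 else 0

/-- `[ω]`, the column space of `ω`, as a subspace of `ℂ^{p+q}`. -/
def colSpace {p q r : ℕ} (ω : MatT p q r) : Submodule ℂ (Fin p ⊕ Fin q → ℂ) :=
  LinearMap.range ω.mulVecLin

/-- One plus the largest index of a nonzero entry of `u`, or `0` if `u = 0`. -/
def lead {n : ℕ} (u : Fin n → ℂ) : ℕ :=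
  Finset.univ.sup fun i => if u i ≠ 0 then (i : ℕ) + 1 else 0

theorem lead_le_iff {n : ℕ} {u : Fin n → ℂ} {m : ℕ} :
    lead u ≤ m ↔ ∀ i : Fin n, m ≤ i → u i = 0 := by
  simp only [lead, Finset.sup_le_iff, Finset.mem_univ, true_imp_iff]
  refine forall_congr' fun i => ?_
  by_cases h : u i = 0
  · simp [h]
  · simp only [ne_eq, h, not_false_eq_true, if_true, imp_false]
    omega

theorem eq_zero_of_lead_le {n : ℕ} {u : Fin n → ℂ} {i : Fin n} (h : lead u ≤ i) : u i = 0 :=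
  lead_le_iff.1 h i le_rfl

theorem lead_lt_of_ne_zero {n : ℕ} {u : Fin n → ℂ} {i : Fin n} (h : u i ≠ 0) : i < lead u := by
  by_contra hlt
  exact h (eq_zero_of_lead_le (not_lt.1 hlt))

theorem exists_ne_zero_of_lt_lead {n : ℕ} {u : Fin n → ℂ} {m : ℕ} (h : m < lead u) :
    ∃ i : Fin n, m ≤ i ∧ u i ≠ 0 := by
  by_contra! hc
  exact absurd (lead_le_iff.2 hc) (not_le.2 h)

theorem exists_lead_eq {n : ℕ} {u : Fin n → ℂ} (h : lead u ≠ 0) :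
    ∃ i : Fin n, lead u = i + 1 ∧ u i ≠ 0 := by
  obtain ⟨i, hi, hu⟩ := exists_ne_zero_of_lt_lead (u := u) (m := lead u - 1) (by omega)
  exact ⟨i, by have := lead_lt_of_ne_zero hu; omega, hu⟩

theorem apply_ne_zero_of_lead_eq {n : ℕ} {u : Fin n → ℂ} {i : Fin n} (h : lead u = i + 1) :
    u i ≠ 0 := by
  obtain ⟨j, hj, hu⟩ := exists_lead_eq (u := u) (by omega)
  rwa [show i = j from Fin.ext (by omega)]

theorem lead_add_smul_le {n : ℕ} (u v : Fin n → ℂ) (s : ℂ) (h : lead v ≤ lead u) :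
    lead (fun i => u i + s * v i) ≤ lead u := by
  refine lead_le_iff.2 fun i hi => ?_
  simp [eq_zero_of_lead_le hi, eq_zero_of_lead_le (h.trans hi)]

theorem exists_lead_add_smul_lt {n : ℕ} {u v : Fin n → ℂ} (h : lead u = lead v)
    (h0 : lead u ≠ 0) : ∃ s : ℂ, lead (fun i => u i + s * v i) < lead u := by
  obtain ⟨k, hk, huk⟩ := exists_lead_eq h0
  have hvk := apply_ne_zero_of_lead_eq (h ▸ hk)
  refine ⟨-(u k / v k), ?_⟩
  rw [hk, Nat.lt_succ_iff]
  refine lead_le_iff.2 fun i hi => ?_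
  rcases hi.eq_or_lt with hi | hi
  · obtain rfl : k = i := Fin.ext hi
    field_simp
    ring
  · have h1 : lead u ≤ i := by omega
    simp [eq_zero_of_lead_le h1, eq_zero_of_lead_le (h ▸ h1)]

theorem lead_mulVec_le {n : ℕ} {b : Matrix (Fin n) (Fin n) ℂ} (hb : b.BlockTriangular id)
    (u : Fin n → ℂ) : lead (b *ᵥ u) ≤ lead u := by
  refine lead_le_iff.2 fun i hi => ?_
  rw [mulVec, dotProduct]
  refine Finset.sum_eq_zero fun k _ => ?_
  rcases lt_or_ge k i with hk | hk
  · rw [hb hk, zero_mul]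
  · rw [eq_zero_of_lead_le (hi.trans hk), mul_zero]

/-- A column operation lowers the total lead if two columns have the same nonzero lead. -/
theorem exists_isUnit_sum_lead_lt {ι : Type*} {m n r : ℕ} (f : Fin m → ι) (h : Fin n → ι)
    (M : Matrix ι (Fin r) ℂ) {c d : Fin r} (hcd : c ≠ d)
    (heq : lead (fun i => M (f i) c) = lead (fun i => M (f i) d))
    (h0 : lead (fun i => M (f i) c) ≠ 0) :
    ∃ t : Matrix (Fin r) (Fin r) ℂ, IsUnit t ∧
      ∑ c, (lead (fun i => (M * t) (f i) c) + lead (fun i => (M * t) (h i) c)) <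
        ∑ c, (lead (fun i => M (f i) c) + lead (fun i => M (h i) c)) := by
  wlog hle : lead (fun i => M (h i) d) ≤ lead (fun i => M (h i) c) generalizing c d
  · exact this hcd.symm heq.symm (heq ▸ h0) (le_of_not_ge hle)
  obtain ⟨s, hs⟩ := exists_lead_add_smul_lt heq h0
  have hM : ∀ x, (M * transvection d c s) x c = M x c + s * M x d := fun x => by
    rw [mul_transvection_apply_same]
  have hM' : ∀ x, ∀ e ≠ c, (M * transvection d c s) x e = M x e := fun x e he =>
    mul_transvection_apply_of_ne _ _ _ _ he _ _
  refine ⟨transvection d c s, ?_, Finset.sum_lt_sum (fun e _ => ?_) ⟨c, Finset.mem_univ _, ?_⟩⟩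
  · rw [isUnit_iff_isUnit_det, det_transvection_of_ne _ _ hcd.symm]
    exact isUnit_one
  · by_cases he : e = c
    · subst he
      simp only [hM]
      exact add_le_add hs.le (lead_add_smul_le _ _ s hle)
    · simp only [hM' _ _ he, le_refl]
  · simp only [hM]
    exact add_lt_add_of_lt_of_le hs (lead_add_smul_le _ _ s hle)

/-- After column operations, the nonzero columns of the top block have distinct leads, and so
do those of the bottom block. -/
theorem exists_isUnit_distinct_lead {p q r : ℕ} (a : MatT p q r) :
    ∃ t : Matrix (Fin r) (Fin r) ℂ, IsUnit t ∧
      (∀ c d, lead (fun i => (a * t) (Sum.inl i) c) = lead (fun i => (a * t) (Sum.inl i) d) →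
        lead (fun i => (a * t) (Sum.inl i) c) ≠ 0 → c = d) ∧
      (∀ c d, lead (fun i => (a * t) (Sum.inr i) c) = lead (fun i => (a * t) (Sum.inr i) d) →
        lead (fun i => (a * t) (Sum.inr i) c) ≠ 0 → c = d) := by
  let Φ : MatT p q r → ℕ := fun M =>
    ∑ c, (lead (fun i => M (Sum.inl i) c) + lead (fun i => M (Sum.inr i) c))
  obtain ⟨t, ht, hmin⟩ := (measure fun t : Matrix (Fin r) (Fin r) ℂ => Φ (a * t)).wf.has_min
    {t | IsUnit t} ⟨1, isUnit_one⟩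
  have hmin' : ∀ s : Matrix (Fin r) (Fin r) ℂ, IsUnit s → ¬ Φ (a * t * s) < Φ (a * t) := fun s hs => by
    rw [Matrix.mul_assoc]
    exact hmin (t * s) (ht.mul hs)
  refine ⟨t, ht, fun c d heq h0 => ?_, fun c d heq h0 => ?_⟩ <;> by_contra hcd
  · obtain ⟨s, hs, hlt⟩ := exists_isUnit_sum_lead_lt Sum.inl Sum.inr (a * t) hcd heq h0
    exact hmin' s hs hlt
  · obtain ⟨s, hs, hlt⟩ := exists_isUnit_sum_lead_lt Sum.inr Sum.inl (a * t) hcd heq h0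
    refine hmin' s hs ?_
    simp only [Φ]
    rw [Finset.sum_add_distrib, Finset.sum_add_distrib] at hlt ⊢
    omega

/-- A matrix whose nonzero columns have distinct leads is an invertible upper triangular matrix
times a partial permutation matrix. -/
theorem exists_upperTriangular_mul_isPartialPerm {n r : ℕ} (u : Matrix (Fin n) (Fin r) ℂ)
    (hu : ∀ c d, lead (fun i => u i c) = lead (fun i => u i d) →
      lead (fun i => u i c) ≠ 0 → c = d) :
    ∃ (b : Matrix (Fin n) (Fin n) ℂ) (τ : Matrix (Fin n) (Fin r) ℂ),
      IsUnit b ∧ b.BlockTriangular id ∧ IsPartialPerm τ ∧ u = b * τ := by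
  let b : Matrix (Fin n) (Fin n) ℂ := Matrix.of fun i k =>
    if h : ∃ c, lead (fun i => u i c) = k + 1 then u i h.choose else if i = k then 1 else 0
  let τ : Matrix (Fin n) (Fin r) ℂ := Matrix.of fun k c =>
    if lead (fun i => u i c) = k + 1 then 1 else 0
  have hb : b.BlockTriangular id := by
    intro i k hik
    have hik : k < i := hik
    simp only [b, of_apply]
    split_ifs with h h'
    · refine eq_zero_of_lead_le (u := fun i => u i h.choose) ?_
      rw [h.choose_spec]
      exact hik
    · exact absurd h' hik.ne'
    · rfl
  have hbτ : ∀ (i k : Fin n) (c : Fin r), lead (fun i => u i c) = k + 1 → b i k = u i c := by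
    intro i k c hc
    have h : ∃ c, lead (fun i => u i c) = k + 1 := ⟨c, hc⟩
    have : h.choose = c := hu _ _ (h.choose_spec.trans hc.symm) (by rw [h.choose_spec]; omega)
    simp only [b, of_apply, dif_pos h, this]
  refine ⟨b, τ, ?_, hb, ⟨fun i j => ?_, fun i j j' h h' => ?_, fun i i' j h h' => ?_⟩, ?_⟩
  · rw [isUnit_iff_isUnit_det, det_of_isUpperTriangular hb, isUnit_iff_ne_zero,
      Finset.prod_ne_zero_iff]
    intro k _
    by_cases h : ∃ c, lead (fun i => u i c) = k + 1
    · obtain ⟨c, hc⟩ := h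
      rw [hbτ k k c hc]
      exact apply_ne_zero_of_lead_eq (u := fun i => u i c) hc
    · simp [b, h]
  · simp only [τ, of_apply]
    split_ifs <;> simp
  · simp only [τ, of_apply, ite_eq_left_iff, zero_ne_one, imp_false, not_not] at h h'
    exact hu _ _ (h.trans h'.symm) (by omega)
  · simp only [τ, of_apply, ite_eq_left_iff, zero_ne_one, imp_false, not_not] at h h'
    exact Fin.ext (by omega)
  · ext i c
    rw [mul_apply]
    by_cases h : lead (fun i => u i c) = 0
    · rw [eq_zero_of_lead_le (u := fun i => u i c) (i := i) (by omega), Finset.sum_eq_zero]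
      intro k _
      simp [τ, h]
    · obtain ⟨k, hk, -⟩ := exists_lead_eq h
      rw [Finset.sum_eq_single k, hbτ i k c hk]
      · simp [τ, hk]
      · intro l _ hl
        have : ¬ lead (fun i => u i c) = l + 1 := fun h' => hl (Fin.ext (by omega))
        simp [τ, this]
      · simp

theorem IsPartialPerm.apply_eq_ite {m n : ℕ} {τ : Matrix (Fin m) (Fin n) ℂ}
    (h : IsPartialPerm τ) (k : Fin m) (c : Fin n) :
    τ k c = if lead (fun i => τ i c) = k + 1 then 1 else 0 := by
  split_ifs with hk
  · exact (h.1 k c).resolve_left (apply_ne_zero_of_lead_eq (u := fun i => τ i c) hk)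
  · refine (h.1 k c).resolve_right fun h1 => hk ?_
    have hlt := lead_lt_of_ne_zero (u := fun i => τ i c) (i := k) (by simp [h1])
    obtain ⟨l, hl, hl0⟩ := exists_lead_eq (u := fun i => τ i c) (by omega)
    rwa [h.2.2 k l c h1 ((h.1 l c).resolve_left hl0)]

theorem IsPartialPerm.lead_mulVec_le_iff {m n : ℕ} {τ : Matrix (Fin m) (Fin n) ℂ}
    (h : IsPartialPerm τ) (x : Fin n → ℂ) (k : ℕ) :
    lead (τ *ᵥ x) ≤ k ↔ ∀ c, ¬ lead (fun i => τ i c) ≤ k → x c = 0 := by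
  rw [lead_le_iff]
  constructor
  · intro hx c hc
    obtain ⟨i, hi, hic⟩ := exists_ne_zero_of_lt_lead (not_le.1 hc)
    have h1 := (h.1 i c).resolve_left hic
    rw [← hx i hi, mulVec, dotProduct, Finset.sum_eq_single c, h1, one_mul]
    · intro d _ hd
      rw [(h.1 i d).resolve_right fun h2 => hd (h.2.1 i d c h2 h1), zero_mul]
    · simp
  · intro hx i hi
    rw [mulVec, dotProduct]
    refine Finset.sum_eq_zero fun c _ => ?_
    by_cases hc : lead (fun i => τ i c) ≤ k
    · rw [eq_zero_of_lead_le (u := fun i => τ i c) (hc.trans hi), zero_mul]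
    · rw [hx c hc, mul_zero]

/-- The vectors supported on the coordinates satisfying `P`. -/
def coordSubspace {r : ℕ} (P : Fin r → Prop) : Submodule ℂ (Fin r → ℂ) where
  carrier := {x | ∀ c, ¬ P c → x c = 0}
  add_mem' hx hy c hc := by simp [hx c hc, hy c hc]
  zero_mem' _ _ := rfl
  smul_mem' s x hx c hc := by simp [hx c hc]

theorem finrank_coordSubspace {r : ℕ} (P : Fin r → Prop) :
    Module.finrank ℂ (coordSubspace P) = Nat.card {c // P c} := by
  let e : coordSubspace P ≃ₗ[ℂ] ({c // P c} → ℂ) :=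
    { toFun := fun x c => x.1 c
      map_add' := fun _ _ => rfl
      map_smul' := fun _ _ => rfl
      invFun := fun y => ⟨fun c => if h : P c then y ⟨c, h⟩ else 0, fun c hc => by simp [hc]⟩
      left_inv := fun x => by
        ext c
        by_cases h : P c
        · simp [h]
        · simp [h, x.2 c h]
      right_inv := fun y => by
        ext c
        simp [c.2] }
  rw [e.finrank_eq, Module.finrank_fintype_fun_eq_card, Nat.card_eq_fintype_card]

theorem card_le_of_mulVec_mem {r : ℕ} {P P' : Fin r → Prop} {h : Matrix (Fin r) (Fin r) ℂ}
    (hh : IsUnit h) (hP : ∀ x ∈ coordSubspace P, h *ᵥ x ∈ coordSubspace P') :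
    Nat.card {c // P c} ≤ Nat.card {c // P' c} := by
  rw [← finrank_coordSubspace, ← finrank_coordSubspace]
  refine LinearMap.finrank_le_finrank_of_injective (f := h.mulVecLin.restrict hP) ?_
  intro x y hxy
  exact Subtype.ext (mulVec_injective_of_isUnit hh (congrArg Subtype.val hxy))

theorem InT.card_lead_le {p q r : ℕ} {ω ω' : MatT p q r} (hω : InT ω) (hω' : InT ω')
    {b₁ : Matrix (Fin p) (Fin p) ℂ} {b₂ : Matrix (Fin q) (Fin q) ℂ}
    {g : Matrix (Fin r) (Fin r) ℂ} (hb₁ : b₁.BlockTriangular id) (hb₂ : b₂.BlockTriangular id)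
    (hg : IsUnit g) (h : ω' * g = fromBlocks b₁ 0 0 b₂ * ω) (i j : ℕ) :
    Nat.card {c // lead (fun k => ω (Sum.inl k) c) ≤ i ∧ lead (fun k => ω (Sum.inr k) c) ≤ j} ≤
      Nat.card
        {c // lead (fun k => ω' (Sum.inl k) c) ≤ i ∧ lead (fun k => ω' (Sum.inr k) c) ≤ j} := by
  refine card_le_of_mulVec_mem hg fun x hx => ?_
  have key : ∀ {η : MatT p q r}, InT η → ∀ y : Fin r → ℂ,
      y ∈ coordSubspace (fun c => lead (fun k => η (Sum.inl k) c) ≤ i ∧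
        lead (fun k => η (Sum.inr k) c) ≤ j) ↔
      lead (η.toRows₁ *ᵥ y) ≤ i ∧ lead (η.toRows₂ *ᵥ y) ≤ j := by
    intro η hη y
    rw [show η.toRows₁ = Matrix.of fun i c => η (Sum.inl i) c from rfl,
      show η.toRows₂ = Matrix.of fun i c => η (Sum.inr i) c from rfl,
      hη.2.1.lead_mulVec_le_iff, hη.2.2.lead_mulVec_le_iff, ← forall_and]
    refine forall_congr' fun c => ?_
    simp only [of_apply]
    tauto
  rw [key hω', mulVec_mulVec, mulVec_mulVec]
  rw [key hω] at hx
  rw [← fromRows_toRows ω, ← fromRows_toRows ω', fromRows_mul, fromBlocks_mul_fromRows,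
    Matrix.zero_mul, Matrix.zero_mul, add_zero, zero_add, fromRows_ext_iff] at h
  rw [h.1, h.2, ← mulVec_mulVec, ← mulVec_mulVec]
  exact ⟨(lead_mulVec_le hb₁ _).trans hx.1, (lead_mulVec_le hb₂ _).trans hx.2⟩

theorem card_and_eq_of_card_and_le {r : ℕ} {P P' : Fin r → Prop} {x x' : Fin r → ℕ}
    (h : ∀ i, Nat.card {c // x c ≤ i ∧ P c} = Nat.card {c // x' c ≤ i ∧ P' c}) (i : ℕ) :
    Nat.card {c // x c = i ∧ P c} = Nat.card {c // x' c = i ∧ P' c} := by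
  cases i with
  | zero => simpa only [Nat.le_zero] using h 0
  | succ i =>
    have key : ∀ (y : Fin r → ℕ) (Q : Fin r → Prop), Nat.card {c // y c ≤ i + 1 ∧ Q c} =
        Nat.card {c // y c ≤ i ∧ Q c} + Nat.card {c // y c = i + 1 ∧ Q c} := by
      intro y Q
      simp only [Nat.card_eq_fintype_card]
      rw [← Fintype.card_subtype_or_disjoint]
      · refine Fintype.card_congr (Equiv.subtypeEquivRight fun c => ?_)
        rw [← or_and_right, Nat.le_succ_iff]
      · rw [Pi.disjoint_iff]
        intro c
        rw [Prop.disjoint_iff]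
        omega
    have := h (i + 1)
    rw [key, key, h i] at this
    omega

theorem exists_perm_of_card_le_eq {r : ℕ} {x x' y y' : Fin r → ℕ}
    (h : ∀ i j, Nat.card {c // x c ≤ i ∧ y c ≤ j} = Nat.card {c // x' c ≤ i ∧ y' c ≤ j}) :
    ∃ w : Equiv.Perm (Fin r), ∀ c, x (w c) = x' c ∧ y (w c) = y' c := by
  have h1 : ∀ j i, Nat.card {c // y c ≤ j ∧ x c = i} =
      Nat.card {c // y' c ≤ j ∧ x' c = i} := fun j i => by
    simpa only [and_comm] using card_and_eq_of_card_and_le (fun i => h i j) i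
  have h2 : ∀ z : ℕ × ℕ, Nonempty ({c // (y' c, x' c) = z} ≃ {c // (y c, x c) = z}) := fun z => by
    refine Finite.card_eq.1 ?_
    simpa only [Prod.ext_iff] using (card_and_eq_of_card_and_le (fun j => h1 j z.2) z.1).symm
  let w : Equiv.Perm (Fin r) := Equiv.ofFiberEquiv fun z => (h2 z).some
  refine ⟨w, fun c => ?_⟩
  have := Equiv.ofFiberEquiv_map (fun z => (h2 z).some) c
  exact ⟨congrArg Prod.snd this, congrArg Prod.fst this⟩

theorem mul_permMat_apply {ι : Type*} {r : ℕ} (M : Matrix ι (Fin r) ℂ) (w : Equiv.Perm (Fin r))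
    (k : ι) (c : Fin r) : (M * permMat w) k c = M k (w c) := by
  simp [mul_apply, permMat]

theorem InT.exists_mul_permMat {p q r : ℕ} {ω ω' : MatT p q r} (hω : InT ω) (hω' : InT ω')
    (h : ∀ i j, Nat.card
        {c // lead (fun k => ω (Sum.inl k) c) ≤ i ∧ lead (fun k => ω (Sum.inr k) c) ≤ j} =
      Nat.card
        {c // lead (fun k => ω' (Sum.inl k) c) ≤ i ∧ lead (fun k => ω' (Sum.inr k) c) ≤ j}) :
    ∃ w : Equiv.Perm (Fin r), ω' = ω * permMat w := by
  obtain ⟨w, hw⟩ := exists_perm_of_card_le_eq h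
  refine ⟨w, ?_⟩
  ext k c
  rw [mul_permMat_apply]
  rcases k with k | k
  · have h1 := hω.2.1.apply_eq_ite k (w c)
    have h2 := hω'.2.1.apply_eq_ite k c
    simp only [of_apply] at h1 h2
    rw [h1, h2]
    exact if_congr (by rw [(hw c).1]) rfl rfl
  · have h1 := hω.2.2.apply_eq_ite k (w c)
    have h2 := hω'.2.2.apply_eq_ite k c
    simp only [of_apply] at h1 h2
    rw [h1, h2]
    exact if_congr (by rw [(hw c).2]) rfl rfl

theorem isUnit_fromBlocks_diagonal {p q : ℕ} {b₁ : Matrix (Fin p) (Fin p) ℂ}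
    {b₂ : Matrix (Fin q) (Fin q) ℂ} (h₁ : IsUnit b₁) (h₂ : IsUnit b₂) :
    IsUnit (fromBlocks b₁ 0 0 b₂) := by
  rw [isUnit_iff_isUnit_det] at *
  rw [det_fromBlocks_zero₂₁]
  exact h₁.mul h₂

/-- Two decompositions of the same matrix relate their representatives by a block-diagonal
upper triangular matrix and an invertible matrix. -/
theorem exists_mul_eq_fromBlocks_mul {p q r : ℕ} {a ω ω' : MatT p q r}
    {b₁ b₁' : Matrix (Fin p) (Fin p) ℂ} {b₂ b₂' : Matrix (Fin q) (Fin q) ℂ}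
    {g g' : Matrix (Fin r) (Fin r) ℂ} (hb₁ : b₁.BlockTriangular id) (hb₂ : b₂.BlockTriangular id)
    (hg : IsUnit g) (hu₁' : IsUnit b₁') (hb₁' : b₁'.BlockTriangular id) (hu₂' : IsUnit b₂')
    (hb₂' : b₂'.BlockTriangular id) (hg' : IsUnit g')
    (h : fromBlocks b₁ 0 0 b₂ * ω * g = a) (h' : fromBlocks b₁' 0 0 b₂' * ω' * g' = a) :
    ∃ (β₁ : Matrix (Fin p) (Fin p) ℂ) (β₂ : Matrix (Fin q) (Fin q) ℂ)
      (t : Matrix (Fin r) (Fin r) ℂ), β₁.BlockTriangular id ∧ β₂.BlockTriangular id ∧ IsUnit t ∧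
        ω' * t = fromBlocks β₁ 0 0 β₂ * ω := by
  have hi₁ := (isUnit_iff_isUnit_det _).1 hu₁'
  have hi₂ := (isUnit_iff_isUnit_det _).1 hu₂'
  have hig := (isUnit_iff_isUnit_det _).1 hg
  let _ := invertibleOfIsUnitDet b₁' hi₁
  let _ := invertibleOfIsUnitDet b₂' hi₂
  refine ⟨b₁'⁻¹ * b₁, b₂'⁻¹ * b₂, g' * g⁻¹,
    (blockTriangular_inv_of_blockTriangular hb₁').mul hb₁,
    (blockTriangular_inv_of_blockTriangular hb₂').mul hb₂,
    hg'.mul (isUnit_nonsing_inv_iff.2 hg), ?_⟩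
  have e1 : fromBlocks (b₁'⁻¹ * b₁) 0 0 (b₂'⁻¹ * b₂) =
      fromBlocks b₁'⁻¹ 0 0 b₂'⁻¹ * fromBlocks b₁ 0 0 b₂ := by
    simp [fromBlocks_multiply]
  have e2 : fromBlocks b₁'⁻¹ 0 0 b₂'⁻¹ * fromBlocks b₁' 0 0 b₂' = 1 := by
    simp [fromBlocks_multiply, nonsing_inv_mul _ hi₁, nonsing_inv_mul _ hi₂]
  calc ω' * (g' * g⁻¹)
      = fromBlocks b₁'⁻¹ 0 0 b₂'⁻¹ * fromBlocks b₁' 0 0 b₂' * (ω' * (g' * g⁻¹)) := by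
        rw [e2, Matrix.one_mul]
    _ = fromBlocks b₁'⁻¹ 0 0 b₂'⁻¹ * (fromBlocks b₁' 0 0 b₂' * ω' * g') * g⁻¹ := by
        simp only [Matrix.mul_assoc]
    _ = fromBlocks b₁'⁻¹ 0 0 b₂'⁻¹ * (fromBlocks b₁ 0 0 b₂ * ω * g) * g⁻¹ := by rw [h, h']
    _ = fromBlocks b₁'⁻¹ 0 0 b₂'⁻¹ * fromBlocks b₁ 0 0 b₂ * ω * (g * g⁻¹) := by
        simp only [Matrix.mul_assoc]
    _ = _ := by rw [mul_nonsing_inv _ hig, Matrix.mul_one, e1]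

/-- every `(p+q) × r` matrix of rank `r` decomposes as
`diag(b₁,b₂) · ω · g` with `b₁, b₂` invertible upper triangular, `ω ∈ 𝕋`,
`g ∈ GL_r(ℂ)`; `ω` is unique up to a permutation of its columns. -/
theorem T_decomposition (p q r : ℕ) (hr : r ≤ p + q) (a : MatT p q r) (ha : a.rank = r) :
    (∃ (b₁ : Matrix (Fin p) (Fin p) ℂ) (b₂ : Matrix (Fin q) (Fin q) ℂ)
        (ω : MatT p q r) (g : Matrix (Fin r) (Fin r) ℂ),
        IsUnit b₁ ∧ b₁.BlockTriangular id ∧ IsUnit b₂ ∧ b₂.BlockTriangular id ∧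
        InT ω ∧ IsUnit g ∧ a = Matrix.fromBlocks b₁ 0 0 b₂ * ω * g) ∧
    (∀ (b₁ b₁' : Matrix (Fin p) (Fin p) ℂ) (b₂ b₂' : Matrix (Fin q) (Fin q) ℂ)
        (ω ω' : MatT p q r) (g g' : Matrix (Fin r) (Fin r) ℂ),
        IsUnit b₁ → b₁.BlockTriangular id → IsUnit b₂ → b₂.BlockTriangular id →
        InT ω → IsUnit g →
        IsUnit b₁' → b₁'.BlockTriangular id → IsUnit b₂' → b₂'.BlockTriangular id →
        InT ω' → IsUnit g' →
        Matrix.fromBlocks b₁ 0 0 b₂ * ω * g = a →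
        Matrix.fromBlocks b₁' 0 0 b₂' * ω' * g' = a →
        ∃ w : Equiv.Perm (Fin r), ω' = ω * permMat w) := by
  constructor
  · obtain ⟨t, ht, h₁, h₂⟩ := exists_isUnit_distinct_lead a
    obtain ⟨b₁, τ₁, hu₁, hb₁, hτ₁, e₁⟩ := exists_upperTriangular_mul_isPartialPerm (a * t).toRows₁ h₁
    obtain ⟨b₂, τ₂, hu₂, hb₂, hτ₂, e₂⟩ := exists_upperTriangular_mul_isPartialPerm (a * t).toRows₂ h₂
    have hdet := (isUnit_iff_isUnit_det _).1 ht
    have hmul : fromBlocks b₁ 0 0 b₂ * fromRows τ₁ τ₂ = a * t := by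
      rw [fromBlocks_mul_fromRows, Matrix.zero_mul, Matrix.zero_mul, add_zero, zero_add, ← e₁, ← e₂,
        fromRows_toRows]
    refine ⟨b₁, b₂, fromRows τ₁ τ₂, t⁻¹, hu₁, hb₁, hu₂, hb₂, ⟨?_, hτ₁, hτ₂⟩,
      isUnit_nonsing_inv_iff.2 ht, ?_⟩
    · have hD := (isUnit_iff_isUnit_det _).1 (isUnit_fromBlocks_diagonal hu₁ hu₂)
      rw [← rank_mul_eq_right_of_isUnit_det _ _ hD, hmul, rank_mul_eq_left_of_isUnit_det _ _ hdet, ha]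
    · rw [hmul, Matrix.mul_assoc, mul_nonsing_inv _ hdet, Matrix.mul_one]
  · intro b₁ b₁' b₂ b₂' ω ω' g g' hu₁ hb₁ hu₂ hb₂ hω hg hu₁' hb₁' hu₂' hb₂' hω' hg' h h'
    refine hω.exists_mul_permMat hω' fun i j => le_antisymm ?_ ?_
    · obtain ⟨β₁, β₂, t, hβ₁, hβ₂, ht, e⟩ :=
        exists_mul_eq_fromBlocks_mul hb₁ hb₂ hg hu₁' hb₁' hu₂' hb₂' hg' h h'
      exact hω.card_lead_le hω' hβ₁ hβ₂ ht e i j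
    · obtain ⟨β₁, β₂, t, hβ₁, hβ₂, ht, e⟩ :=
        exists_mul_eq_fromBlocks_mul hb₁' hb₂' hg' hu₁ hb₁ hu₂ hb₂ hg h' h
      exact hω'.card_lead_le hω hβ₁ hβ₂ ht e i j
end
end
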